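/- arXiv:2004.01774 — 16 statements merged into one kernel-verified Lean document; each statement's English description precedes it below -/
import Mathlib

section
/- Let A be a left-symmetric algebra and H ∈ Sym²(A) a symmetric 2-tensor such that H^♯: A* → A is bijective. Then ⟦H,H⟧ = 0 if and only if the symmetric bilinear form H⁻¹ on A defined by H⁻¹(x,y) := ((H^♯)⁻¹(x))(y) is a 2-cocycle, i.e. δ_A(H⁻¹) = 0. -/
open Module

variable {A : Type*} [AddCommGroup A] [Module ℝ A] [FiniteDimensional ℝ A]

/-- The product `mul` is left-symmetric: the associator is symmetric in its
first two arguments. -/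
def IsLS (mul : A →ₗ[ℝ] A →ₗ[ℝ] A) : Prop :=
  ∀ x y z : A, mul x (mul y z) - mul (mul x y) z = mul y (mul x z) - mul (mul y x) z

/-- The commutator bracket `[x,y] = x·y − y·x`. -/
def br (mul : A →ₗ[ℝ] A →ₗ[ℝ] A) (x y : A) : A := mul x y - mul y x

/-- `⟦H,H⟧(α₁,α₂,α₃)` over a point. -/
def KVbr (mul : A →ₗ[ℝ] A →ₗ[ℝ] A) (Hs : Dual ℝ A →ₗ[ℝ] A)
    (α₁ α₂ α₃ : Dual ℝ A) : ℝ :=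
  α₁ (mul (Hs α₂) (Hs α₃)) - α₂ (mul (Hs α₁) (Hs α₃)) - α₃ (br mul (Hs α₁) (Hs α₂))

/-- `H^♯` encodes a symmetric 2-tensor. -/
def IsSymmT (Hs : Dual ℝ A →ₗ[ℝ] A) : Prop :=
  ∀ α β : Dual ℝ A, α (Hs β) = β (Hs α)

/-- `H` is a Koszul-Vinberg structure: `⟦H,H⟧ = 0`. -/
def IsKV (mul : A →ₗ[ℝ] A →ₗ[ℝ] A) (Hs : Dual ℝ A →ₗ[ℝ] A) : Prop :=
  ∀ α₁ α₂ α₃ : Dual ℝ A, KVbr mul Hs α₁ α₂ α₃ = 0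

/-- The induced product on the dual: `(α ·^H β)(y) = −β([H^♯α, y]) + α(y · H^♯β)`. -/
def dualMul (mul : A →ₗ[ℝ] A →ₗ[ℝ] A) (Hs : Dual ℝ A →ₗ[ℝ] A)
    (α β : Dual ℝ A) : Dual ℝ A :=
  -(β ∘ₗ (mul (Hs α) - mul.flip (Hs α))) + α ∘ₗ mul.flip (Hs β)

/-- Nijenhuis operator. -/
def IsNij (mul : A →ₗ[ℝ] A →ₗ[ℝ] A) (N : A →ₗ[ℝ] A) : Prop :=
  ∀ x y : A, mul (N x) (N y) = N (mul (N x) y + mul x (N y) - N (mul x y))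

/-- Deformed product `x ·_N y = N(x)·y + x·N(y) − N(x·y)`. -/
def mulN (mul : A →ₗ[ℝ] A →ₗ[ℝ] A) (N : A →ₗ[ℝ] A) : A →ₗ[ℝ] A →ₗ[ℝ] A :=
  mul ∘ₗ N + (mul.flip ∘ₗ N).flip - (LinearMap.llcomp ℝ A A A N) ∘ₗ mul

/-- Deformation of the dual product by an endomorphism `S` of the dual:
`α ·^H_S β = S(α) ·^H β + α ·^H S(β) − S(α ·^H β)`. -/
def dmulE (mul : A →ₗ[ℝ] A →ₗ[ℝ] A) (Hs : Dual ℝ A →ₗ[ℝ] A)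
    (S : Dual ℝ A →ₗ[ℝ] Dual ℝ A) (α β : Dual ℝ A) : Dual ℝ A :=
  dualMul mul Hs (S α) β + dualMul mul Hs α (S β) - S (dualMul mul Hs α β)

/-- Koszul-Vinberg-Nijenhuis structure: `H` is KV, `N` is Nijenhuis,
`N∘H^♯ = H^♯∘N*`, and `α ⋆^H β = α ·^H_{N*} β`.  (Note that
`α ⋆^H β = dualMul (mulN mul N) Hs α β`.) -/
def IsKVN (mul : A →ₗ[ℝ] A →ₗ[ℝ] A) (Hs : Dual ℝ A →ₗ[ℝ] A) (N : A →ₗ[ℝ] A) : Prop :=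
  IsKV mul Hs ∧ IsNij mul N ∧ N ∘ₗ Hs = Hs ∘ₗ N.dualMap ∧
  ∀ α β : Dual ℝ A, dualMul (mulN mul N) Hs α β = dmulE mul Hs N.dualMap α β

/-- `2⟦H₁,H₂⟧(α₁,α₂,α₃)` over a point. -/
noncomputable def KVbr2 (mul : A →ₗ[ℝ] A →ₗ[ℝ] A) (H1s H2s : Dual ℝ A →ₗ[ℝ] A)
    (α₁ α₂ α₃ : Dual ℝ A) : ℝ :=
  (α₁ (mul (H1s α₂) (H2s α₃)) + α₁ (mul (H2s α₂) (H1s α₃))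
    - α₂ (mul (H1s α₁) (H2s α₃)) - α₂ (mul (H2s α₁) (H1s α₃))
    - α₃ (br mul (H1s α₁) (H2s α₂)) - α₃ (br mul (H2s α₁) (H1s α₂))) / 2

/-- A bilinear form (given via `𝔅^♮ : A → A*`) is a 2-cocycle:
`𝔅(x, y·z) − 𝔅(y, x·z) − 𝔅([x,y], z) = 0`. -/
def IsCocycle (mul : A →ₗ[ℝ] A →ₗ[ℝ] A) (B : A →ₗ[ℝ] Dual ℝ A) : Prop :=
  ∀ x y z : A, B x (mul y z) - B y (mul x z) - B (br mul x y) z = 0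

/-- Symmetry of a bilinear form. -/
def IsSymmB (B : A →ₗ[ℝ] Dual ℝ A) : Prop := ∀ x y : A, B x y = B y x

/-- KVB-structure: `𝔅` is a symmetric 2-cocycle and `𝔅_N`, with
`N = H^♯∘𝔅^♮`, is also a 2-cocycle. -/
def IsKVB (mul : A →ₗ[ℝ] A →ₗ[ℝ] A) (Hs : Dual ℝ A →ₗ[ℝ] A)
    (B : A →ₗ[ℝ] Dual ℝ A) : Prop :=
  IsSymmB B ∧ IsCocycle mul B ∧ IsCocycle mul (B ∘ₗ (Hs ∘ₗ B))

/-- `𝔅` is complementary for `H`: `⟦𝔅,𝔅⟧_{A*} = 0`, written out over a point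
with `T = H^♯∘𝔅^♮`. -/
def IsComplementary (mul : A →ₗ[ℝ] A →ₗ[ℝ] A) (Hs : Dual ℝ A →ₗ[ℝ] A)
    (B : A →ₗ[ℝ] Dual ℝ A) : Prop :=
  ∀ x y z : A,
    -B (mul ((Hs ∘ₗ B) y) z) x - B (mul y ((Hs ∘ₗ B) z)) x
    + B (mul ((Hs ∘ₗ B) x) z) y + B (mul x ((Hs ∘ₗ B) z)) y
    + B (br mul ((Hs ∘ₗ B) x) y) z - B (br mul ((Hs ∘ₗ B) y) x) z = 0

/-- Pseudo-Hessian-Nijenhuis structure: `𝔅` a symmetric 2-cocycle, `N`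
Nijenhuis, `𝔅(N x, y) = 𝔅(x, N y)`, and `𝔅_N` a 2-cocycle. -/
def IsHN (mul : A →ₗ[ℝ] A →ₗ[ℝ] A) (B : A →ₗ[ℝ] Dual ℝ A) (N : A →ₗ[ℝ] A) : Prop :=
  IsSymmB B ∧ IsCocycle mul B ∧ IsNij mul N ∧ (∀ x y : A, B (N x) y = B x (N y)) ∧
  IsCocycle mul (B ∘ₗ N)
/-- For a left-symmetric algebra `A` and a symmetric 2-tensor `H`
with `H^♯` bijective (witnessed by the two-sided inverse `K = (H^♯)⁻¹`),
`⟦H,H⟧ = 0` iff `H⁻¹ = K` is a 2-cocycle. -/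
theorem kv_iff_inverse_cocycle
    (mul : A →ₗ[ℝ] A →ₗ[ℝ] A) (hls : IsLS mul)
    (Hs : Dual ℝ A →ₗ[ℝ] A) (hsym : IsSymmT Hs)
    (K : A →ₗ[ℝ] Dual ℝ A) (hK1 : ∀ x : A, Hs (K x) = x)
    (hK2 : ∀ α : Dual ℝ A, K (Hs α) = α) :
    IsKV mul Hs ↔ IsCocycle mul K := by
  have hs : ∀ x y : A, K x y = K y x := by
    intro x y
    have h := hsym (K x) (K y)
    rwa [hK1, hK1] at h
  constructor
  · intro h x y z
    have h1 := h (K x) (K y) (K z)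
    simp only [KVbr, hK1] at h1
    rw [hs (br mul x y) z]
    exact h1
  · intro h a b c
    have h1 := h (Hs a) (Hs b) (Hs c)
    rw [hs (br mul (Hs a) (Hs b)) (Hs c)] at h1
    simp only [hK2] at h1
    exact h1
end

section
/- If H is a Koszul-Vinberg structure on a left-symmetric algebra A (i.e. ⟦H,H⟧ = 0), then the product ·^H makes A* a left-symmetric algebra (the associator of ·^H is symmetric in its first two arguments), and H^♯ is an algebra homomorphism from (A*, ·^H) to (A, ·): H^♯(α ·^H β) = H^♯(α) · H^♯(β) for all α, β ∈ A*. -/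
open Module

variable {A : Type*} [AddCommGroup A] [Module ℝ A] [FiniteDimensional ℝ A]

/-- if `H` is a Koszul-Vinberg structure, then `·^H` is a
left-symmetric product on `A*` and `H^♯` is an algebra homomorphism. -/
theorem dual_leftSymmetric_and_hom
    (mul : A →ₗ[ℝ] A →ₗ[ℝ] A) (hls : IsLS mul)
    (Hs : Dual ℝ A →ₗ[ℝ] A) (hsym : IsSymmT Hs) (hkv : IsKV mul Hs) :
    (∀ α β γ : Dual ℝ A,
      dualMul mul Hs α (dualMul mul Hs β γ)
        - dualMul mul Hs (dualMul mul Hs α β) γ =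
      dualMul mul Hs β (dualMul mul Hs α γ)
        - dualMul mul Hs (dualMul mul Hs β α) γ) ∧
    (∀ α β : Dual ℝ A, Hs (dualMul mul Hs α β) = mul (Hs α) (Hs β)) := by
  have hd : ∀ (α β : Dual ℝ A) (y : A), dualMul mul Hs α β y
      = -(β (mul (Hs α) y) - β (mul y (Hs α))) + α (mul y (Hs β)) := by
    intro α β y
    simp [dualMul]
  have hom : ∀ α β : Dual ℝ A, Hs (dualMul mul Hs α β) = mul (Hs α) (Hs β) := by
    intro α β
    rw [← sub_eq_zero, ← Module.forall_dual_apply_eq_zero_iff ℝ]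
    intro γ
    have h := hkv α γ β
    simp only [KVbr, br, map_sub] at h
    rw [map_sub, hsym γ, hd]
    linarith
  refine ⟨?_, hom⟩
  intro α β γ
  ext y
  simp only [LinearMap.sub_apply, hd, hom]
  have e1 := congrArg β (hls (Hs α) y (Hs γ))
  have e2 := congrArg α (hls (Hs β) y (Hs γ))
  have e3 := congrArg γ (hls (Hs α) (Hs β) y)
  have e4 := congrArg γ (hls (Hs α) y (Hs β))
  have e5 := congrArg γ (hls (Hs β) y (Hs α))
  simp only [map_sub] at e1 e2 e3 e4 e5
  linarith
end

section
/- Let H be a Koszul-Vinberg structure and N a Nijenhuis operator on a left-symmetric algebra A such that N∘H^♯ = H^♯∘N*. Then for all α,β ∈ A*: α ⋆^H β + α ·^H_{N*} β = 2 (α ·^{H_N} β), where H_N is the symmetric 2-tensor with (H_N)^♯ := N∘H^♯ and ·^{H_N} is the induced product on A* built from H_N. -/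
open Module

variable {A : Type*} [AddCommGroup A] [Module ℝ A] [FiniteDimensional ℝ A]

/-- `α ⋆^H β + α ·^H_{N*} β = 2 (α ·^{H_N} β)` whenever
`N∘H^♯ = H^♯∘N*`, for a KV structure `H` and a Nijenhuis operator `N`. -/
theorem star_add_deformed_eq_two_smul
    (mul : A →ₗ[ℝ] A →ₗ[ℝ] A) (hls : IsLS mul)
    (Hs : Dual ℝ A →ₗ[ℝ] A) (hsym : IsSymmT Hs) (hkv : IsKV mul Hs)
    (N : A →ₗ[ℝ] A) (hN : IsNij mul N)
    (hcomm : N ∘ₗ Hs = Hs ∘ₗ N.dualMap) :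
    ∀ α β : Dual ℝ A,
      dualMul (mulN mul N) Hs α β + dmulE mul Hs N.dualMap α β
        = (2 : ℝ) • dualMul mul (N ∘ₗ Hs) α β := by
  intro α β
  have h : ∀ γ : Dual ℝ A, Hs (N.dualMap γ) = N (Hs γ) := fun γ =>
    (LinearMap.congr_fun hcomm γ).symm
  ext y
  simp only [dualMul, dmulE, mulN, h, LinearMap.add_apply, LinearMap.sub_apply,
    LinearMap.neg_apply, LinearMap.smul_apply, LinearMap.comp_apply, LinearMap.flip_apply,
    LinearMap.llcomp_apply, LinearMap.dualMap_apply, map_add, map_sub, smul_eq_mul]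
  ring
end

section
/- If (H,N) is a KVN-structure on a left-symmetric algebra A, then N* is a Nijenhuis operator on the left-symmetric algebra (A*, ·^H): N*(α) ·^H N*(β) = N*( N*(α) ·^H β + α ·^H N*(β) − N*(α ·^H β) ) for all α,β ∈ A*. -/
open Module

variable {A : Type*} [AddCommGroup A] [Module ℝ A] [FiniteDimensional ℝ A]

/-- for a KVN-structure `(H,N)`, the transpose `N*` is a
Nijenhuis operator on `(A*, ·^H)`. -/
theorem dualMap_nijenhuis_of_KVN
    (mul : A →ₗ[ℝ] A →ₗ[ℝ] A) (hls : IsLS mul)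
    (Hs : Dual ℝ A →ₗ[ℝ] A) (hsym : IsSymmT Hs)
    (N : A →ₗ[ℝ] A) (h : IsKVN mul Hs N) :
    ∀ α β : Dual ℝ A,
      dualMul mul Hs (N.dualMap α) (N.dualMap β)
        = N.dualMap (dualMul mul Hs (N.dualMap α) β
            + dualMul mul Hs α (N.dualMap β)
            - N.dualMap (dualMul mul Hs α β)) := by
  obtain ⟨-, hN, hH, hc⟩ := h
  intro α β
  have hH' : ∀ γ : Dual ℝ A, Hs (N.dualMap γ) = N (Hs γ) := fun γ =>
    (LinearMap.congr_fun hH γ).symm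
  have hn : ∀ x y : A, mul (N x) (N y) = N (mul (N x) y) + N (mul x (N y)) - N (N (mul x y)) := by
    intro x y
    rw [hN x y, map_sub, map_add]
  -- the compatibility condition, in simplified form
  have C : ∀ (β : Dual ℝ A) (y : A),
      β (mul (Hs α) (N y)) - β (mul (N y) (Hs α)) - β (N (mul (Hs α) y)) + β (N (mul y (Hs α)))
        = α (mul (N y) (Hs β)) - α (N (mul y (Hs β))) := by
    intro β y
    have := LinearMap.congr_fun (hc α β) y
    simp [dualMul, mulN, dmulE, hH', LinearMap.dualMap_apply] at this
    linarith
  ext y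
  have h1 := C β (N y)
  have h2 := C (N.dualMap β) y
  have h3 := congrArg β (hn (Hs α) y)
  have h4 := congrArg β (hn y (Hs α))
  have h5 := congrArg α (hn y (Hs β))
  simp only [hH', LinearMap.dualMap_apply, map_add, map_sub] at h1 h2 h3 h4 h5
  simp [dualMul, hH', LinearMap.dualMap_apply]
  linarith
end

section
/- If (H,N) is a KVN-structure on a left-symmetric algebra A, then for all α,β ∈ A*: H^♯(α ·^H_{N*} β) = H^♯(α) ·_N H^♯(β) and (N∘H^♯)(α ·^H_{N*} β) = (N∘H^♯)(α) · (N∘H^♯)(β); that is, H^♯ is an algebra homomorphism from (A*, ·^H_{N*}) to (A, ·_N), and N∘H^♯ is an algebra homomorphism from (A*, ·^H_{N*}) to (A, ·). -/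
open Module

variable {A : Type*} [AddCommGroup A] [Module ℝ A] [FiniteDimensional ℝ A]

/-- For a Koszul-Vinberg structure, `H^♯` is a homomorphism `(A*, ·^H) → (A, ·)`. -/
theorem sharp_dualMul
    (mul : A →ₗ[ℝ] A →ₗ[ℝ] A) (Hs : Dual ℝ A →ₗ[ℝ] A) (hsym : IsSymmT Hs)
    (h : IsKV mul Hs) (α β : Dual ℝ A) :
    Hs (dualMul mul Hs α β) = mul (Hs α) (Hs β) := by
  rw [← sub_eq_zero, ← Module.forall_dual_apply_eq_zero_iff ℝ]
  intro γ
  have h1 := h α γ β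
  rw [map_sub, hsym]
  simp only [KVbr, br, dualMul, map_sub, LinearMap.add_apply, LinearMap.neg_apply,
    LinearMap.comp_apply, LinearMap.sub_apply, LinearMap.flip_apply] at h1 ⊢
  linarith

/-- for a KVN-structure `(H,N)`, `H^♯` is a homomorphism from
`(A*, ·^H_{N*})` to `(A, ·_N)` and `N∘H^♯` is a homomorphism from
`(A*, ·^H_{N*})` to `(A, ·)`. -/
theorem sharp_hom_of_KVN
    (mul : A →ₗ[ℝ] A →ₗ[ℝ] A) (hls : IsLS mul)
    (Hs : Dual ℝ A →ₗ[ℝ] A) (hsym : IsSymmT Hs)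
    (N : A →ₗ[ℝ] A) (h : IsKVN mul Hs N) :
    ∀ α β : Dual ℝ A,
      Hs (dmulE mul Hs N.dualMap α β) = mulN mul N (Hs α) (Hs β) ∧
      N (Hs (dmulE mul Hs N.dualMap α β)) = mul (N (Hs α)) (N (Hs β)) := by
  intro α β
  obtain ⟨hkv, hnij, hc, -⟩ := h
  have hc' : ∀ γ, Hs (N.dualMap γ) = N (Hs γ) := fun γ => (LinearMap.congr_fun hc γ).symm
  have h1 : Hs (dmulE mul Hs N.dualMap α β) =
      mul (N (Hs α)) (Hs β) + mul (Hs α) (N (Hs β)) - N (mul (Hs α) (Hs β)) := by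
    simp only [dmulE, map_sub, map_add, hc', sharp_dualMul mul Hs hsym hkv]
  refine ⟨?_, ?_⟩
  · rw [h1]
    simp [mulN]
  · rw [h1, hnij]
end

section
/- If (H,N) is a KVN-structure on a left-symmetric algebra A, then H_N, the symmetric 2-tensor defined by (H_N)^♯ := N∘H^♯, satisfies ⟦H_N, H_N⟧ = 0 (so H_N is a Koszul-Vinberg structure), and moreover H is a Koszul-Vinberg structure for the deformed left-symmetric algebra (A, ·_N), i.e. the bracket ⟦H,H⟧ computed using the product ·_N and the bracket [·,·]_N vanishes. -/
open Module

variable {A : Type*} [AddCommGroup A] [Module ℝ A] [FiniteDimensional ℝ A]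

/-- for a KVN-structure `(H,N)`, `H_N` (with `(H_N)^♯ = N∘H^♯`)
is a Koszul-Vinberg structure, and `H` is a Koszul-Vinberg structure for the
deformed left-symmetric algebra `(A, ·_N)`. -/
theorem HN_and_deformed_KV_of_KVN
    (mul : A →ₗ[ℝ] A →ₗ[ℝ] A) (hls : IsLS mul)
    (Hs : Dual ℝ A →ₗ[ℝ] A) (hsym : IsSymmT Hs)
    (N : A →ₗ[ℝ] A) (h : IsKVN mul Hs N) :
    IsKV mul (N ∘ₗ Hs) ∧ IsKV (mulN mul N) Hs := by
  obtain ⟨hK, hN, hc, hC⟩ := h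
  have hc' : ∀ α, Hs (α ∘ₗ N) = N (Hs α) := fun α => (LinearMap.congr_fun hc α).symm
  have C : ∀ (α β : Dual ℝ A) (y : A), _ := fun α β y => LinearMap.congr_fun (hC α β) y
  simp only [dualMul, dmulE, mulN, LinearMap.dualMap_apply', hc', LinearMap.add_apply,
    LinearMap.sub_apply, LinearMap.neg_apply, LinearMap.comp_apply, LinearMap.flip_apply,
    LinearMap.llcomp_apply, map_sub, map_add] at C
  simp only [IsKV, KVbr, br, map_sub] at hK
  constructor
  · intro α γ β
    have k1 := hK (α ∘ₗ N) (γ ∘ₗ N) β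
    have k2 := hK α (γ ∘ₗ N) (β ∘ₗ N)
    have k3 := hK α ((γ ∘ₗ N) ∘ₗ N) β
    have c := C α β (N (Hs γ))
    have n := congrArg γ (hN (Hs α) (Hs β))
    simp only [hc', LinearMap.comp_apply, map_sub, map_add] at k1 k2 k3 n
    simp only [KVbr, br, LinearMap.comp_apply, map_sub]
    linarith
  · intro α γ β
    have k1 := hK (α ∘ₗ N) γ β
    have k2 := hK α γ (β ∘ₗ N)
    have k3 := hK α (γ ∘ₗ N) β
    have c := C α β (Hs γ)
    simp only [hc', LinearMap.comp_apply] at k1 k2 k3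
    simp only [KVbr, br, mulN, LinearMap.add_apply, LinearMap.sub_apply, LinearMap.comp_apply,
      LinearMap.flip_apply, LinearMap.llcomp_apply, map_sub, map_add]
    linarith
end

section
/- If (H,N) is a KVN-structure on a left-symmetric algebra A, then H and H_N are compatible: ⟦H, H_N⟧ = 0, where H_N is the symmetric 2-tensor with (H_N)^♯ := N∘H^♯. -/
open Module

variable {A : Type*} [AddCommGroup A] [Module ℝ A] [FiniteDimensional ℝ A]

/-- for a KVN-structure `(H,N)`, `H` and `H_N` are compatible:
`⟦H, H_N⟧ = 0`. -/
theorem compatible_H_HN_of_KVN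
    (mul : A →ₗ[ℝ] A →ₗ[ℝ] A) (hls : IsLS mul)
    (Hs : Dual ℝ A →ₗ[ℝ] A) (hsym : IsSymmT Hs)
    (N : A →ₗ[ℝ] A) (h : IsKVN mul Hs N) :
    ∀ α₁ α₂ α₃ : Dual ℝ A, KVbr2 mul Hs (N ∘ₗ Hs) α₁ α₂ α₃ = 0 := by
  obtain ⟨hKV, -, hc, hC⟩ := h
  intro a b c
  have hc' : ∀ α : Dual ℝ A, Hs (N.dualMap α) = N (Hs α) := fun α =>
    (LinearMap.congr_fun hc α).symm
  have k1 := hKV a b (N.dualMap c)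
  have k2 := hKV (N.dualMap a) b c
  have k3 := LinearMap.congr_fun (hC a c) (Hs b)
  simp only [KVbr, br, dualMul, mulN, dmulE, hc', LinearMap.dualMap_apply, LinearMap.add_apply,
    LinearMap.sub_apply, LinearMap.neg_apply, LinearMap.comp_apply, LinearMap.flip_apply,
    LinearMap.llcomp_apply, map_add, map_sub, map_neg] at k1 k2 k3
  simp only [KVbr2, br, LinearMap.comp_apply, map_sub]
  linarith
end

section
/- Let (H,N) be a KVN-structure on a left-symmetric algebra A. Then for every k ∈ ℕ, the symmetric 2-tensor H_{N^k} defined by (H_{N^k})^♯ := N^k∘H^♯ is a Koszul-Vinberg structure, and for all k, l ∈ ℕ, H_{N^k} and H_{N^l} are compatible: ⟦H_{N^k}, H_{N^l}⟧ = 0. -/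
open Module

variable {A : Type*} [AddCommGroup A] [Module ℝ A] [FiniteDimensional ℝ A]

theorem pow_comm_app (N : A →ₗ[ℝ] A) (l : ℕ) (v : A) : (N ^ l) (N v) = N ((N ^ l) v) := by
  rw [← Module.End.mul_apply, ← Module.End.mul_apply, ← pow_succ, ← pow_succ']

theorem pow_succ_app (N : A →ₗ[ℝ] A) (l : ℕ) (v : A) : (N ^ (l + 1)) v = N ((N ^ l) v) := by
  rw [pow_succ', Module.End.mul_apply]

theorem pow_comm_app' (N : A →ₗ[ℝ] A) (k l : ℕ) (v : A) :
    (N ^ l) ((N ^ k) v) = (N ^ k) ((N ^ l) v) := by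
  rw [← Module.End.mul_apply, ← Module.End.mul_apply, ← pow_add, ← pow_add, add_comm]

theorem nij_one (mul : A →ₗ[ℝ] A →ₗ[ℝ] A) (N : A →ₗ[ℝ] A) (hN : IsNij mul N)
    (l : ℕ) (x y : A) :
    mul (N x) ((N ^ l) y) =
      N (mul x ((N ^ l) y)) + (N ^ l) (mul (N x) y) - N ((N ^ l) (mul x y)) := by
  induction l with
  | zero => simp
  | succ l ih =>
    simp only [pow_succ_app]
    rw [hN x ((N ^ l) y), ih]
    simp only [map_add, map_sub]
    abel

/-- Mixed Nijenhuis identity for powers of `N`. -/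
theorem nij_pow (mul : A →ₗ[ℝ] A →ₗ[ℝ] A) (N : A →ₗ[ℝ] A) (hN : IsNij mul N)
    (k l : ℕ) (x y : A) :
    mul ((N ^ k) x) ((N ^ l) y) =
      (N ^ k) (mul x ((N ^ l) y)) + (N ^ l) (mul ((N ^ k) x) y)
        - (N ^ k) ((N ^ l) (mul x y)) := by
  induction k with
  | zero => simp
  | succ k ih =>
    simp only [pow_succ_app]
    rw [nij_one mul N hN l ((N ^ k) x) y, ih]
    simp only [map_add, map_sub]
    abel

theorem nij_pow_br (mul : A →ₗ[ℝ] A →ₗ[ℝ] A) (N : A →ₗ[ℝ] A) (hN : IsNij mul N)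
    (k l : ℕ) (x y : A) :
    br mul ((N ^ k) x) ((N ^ l) y) =
      (N ^ k) (br mul x ((N ^ l) y)) + (N ^ l) (br mul ((N ^ k) x) y)
        - (N ^ k) ((N ^ l) (br mul x y)) := by
  unfold br
  rw [nij_pow mul N hN k l x y, nij_pow mul N hN l k y x]
  simp only [map_sub]
  rw [pow_comm_app' N k l (mul y x)]
  abel

theorem compat_one (mul : A →ₗ[ℝ] A →ₗ[ℝ] A) (Hs : Dual ℝ A →ₗ[ℝ] A) (N : A →ₗ[ℝ] A)
    (hH : ∀ α : Dual ℝ A, N (Hs α) = Hs (N.dualMap α))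
    (h : ∀ α β : Dual ℝ A, dualMul (mulN mul N) Hs α β = dmulE mul Hs N.dualMap α β)
    (α β : Dual ℝ A) (y : A) :
    α (mul (N y) (Hs β)) = α (N (mul y (Hs β)))
      + β (br mul (Hs α) (N y)) - β (N (br mul (Hs α) y)) := by
  have e := LinearMap.congr_fun (h α β) y
  simp only [dualMul, dmulE, mulN, br, ← hH, LinearMap.add_apply, LinearMap.sub_apply,
    LinearMap.neg_apply, LinearMap.comp_apply, LinearMap.flip_apply, LinearMap.dualMap_apply,
    LinearMap.llcomp_apply, map_add, map_sub] at e ⊢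
  linarith

theorem compat_pow (mul : A →ₗ[ℝ] A →ₗ[ℝ] A) (Hs : Dual ℝ A →ₗ[ℝ] A) (N : A →ₗ[ℝ] A)
    (hN : IsNij mul N)
    (hH : ∀ α : Dual ℝ A, N (Hs α) = Hs (N.dualMap α))
    (h : ∀ α β : Dual ℝ A, dualMul (mulN mul N) Hs α β = dmulE mul Hs N.dualMap α β)
    (k : ℕ) (α β : Dual ℝ A) (y : A) :
    α (mul ((N ^ k) y) (Hs β)) = α ((N ^ k) (mul y (Hs β)))
      + β (br mul (Hs α) ((N ^ k) y)) - β ((N ^ k) (br mul (Hs α) y)) := by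
  induction k generalizing α with
  | zero => simp
  | succ k ih =>
    have e1 := compat_one mul Hs N hH h α β ((N ^ k) y)
    have e2 := ih (N.dualMap α)
    have e3 := congrArg β (nij_pow_br mul N hN 1 k (Hs α) y)
    simp only [← hH, LinearMap.dualMap_apply] at e2
    simp only [pow_one, map_add, map_sub] at e3
    simp only [pow_succ_app]
    linarith

theorem pow_Hs (Hs : Dual ℝ A →ₗ[ℝ] A) (N : A →ₗ[ℝ] A)
    (hH : ∀ α : Dual ℝ A, N (Hs α) = Hs (N.dualMap α)) (k : ℕ) (α : Dual ℝ A) :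
    Hs (α ∘ₗ (N ^ k)) = (N ^ k) (Hs α) := by
  induction k with
  | zero => rfl
  | succ k ih =>
    rw [pow_succ_app, ← ih, hH]
    congr 1

theorem half_identity (mul : A →ₗ[ℝ] A →ₗ[ℝ] A) (Hs : Dual ℝ A →ₗ[ℝ] A) (N : A →ₗ[ℝ] A)
    (hK : IsKV mul Hs) (hN : IsNij mul N)
    (hH : ∀ α : Dual ℝ A, N (Hs α) = Hs (N.dualMap α))
    (h : ∀ α β : Dual ℝ A, dualMul (mulN mul N) Hs α β = dmulE mul Hs N.dualMap α β)
    (k l : ℕ) (α₁ α₂ α₃ : Dual ℝ A) :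
    α₁ (mul ((N ^ k) (Hs α₂)) ((N ^ l) (Hs α₃)))
      - α₂ (mul ((N ^ k) (Hs α₁)) ((N ^ l) (Hs α₃)))
      = α₃ ((N ^ l) (br mul (Hs α₁) ((N ^ k) (Hs α₂))))
        + α₃ ((N ^ l) (br mul ((N ^ k) (Hs α₁)) (Hs α₂)))
        - α₃ ((N ^ l) ((N ^ k) (br mul (Hs α₁) (Hs α₂)))) := by
  have e1 := compat_pow mul Hs N hN hH h k α₁ (α₃ ∘ₗ (N ^ l)) (Hs α₂)
  have e2 := hK (α₁ ∘ₗ (N ^ k)) α₂ (α₃ ∘ₗ (N ^ l))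
  simp only [KVbr, pow_Hs Hs N hH, LinearMap.comp_apply] at e1 e2
  linarith

theorem compat_all (mul : A →ₗ[ℝ] A →ₗ[ℝ] A) (Hs : Dual ℝ A →ₗ[ℝ] A) (N : A →ₗ[ℝ] A)
    (h : IsKVN mul Hs N) (k l : ℕ) (α₁ α₂ α₃ : Dual ℝ A) :
    KVbr2 mul ((N ^ k) ∘ₗ Hs) ((N ^ l) ∘ₗ Hs) α₁ α₂ α₃ = 0 := by
  obtain ⟨hK, hN, hH', hC⟩ := h
  have hH : ∀ α : Dual ℝ A, N (Hs α) = Hs (N.dualMap α) := fun α => LinearMap.congr_fun hH' α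
  have e1 := half_identity mul Hs N hK hN hH hC k l α₁ α₂ α₃
  have e2 := half_identity mul Hs N hK hN hH hC l k α₁ α₂ α₃
  have e3 := congrArg α₃ (nij_pow_br mul N hN k l (Hs α₁) (Hs α₂))
  have e4 := congrArg α₃ (nij_pow_br mul N hN l k (Hs α₁) (Hs α₂))
  simp only [map_add, map_sub] at e3 e4
  simp only [KVbr2, LinearMap.comp_apply]
  linarith

/-- for a KVN-structure `(H,N)`, every `H_{N^k}` is a
Koszul-Vinberg structure and any two `H_{N^k}`, `H_{N^l}` are compatible. -/
theorem hierarchy_of_KV_structures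
    (mul : A →ₗ[ℝ] A →ₗ[ℝ] A) (hls : IsLS mul)
    (Hs : Dual ℝ A →ₗ[ℝ] A) (hsym : IsSymmT Hs)
    (N : A →ₗ[ℝ] A) (h : IsKVN mul Hs N) :
    (∀ k : ℕ, IsKV mul ((N ^ k) ∘ₗ Hs)) ∧
    (∀ (k l : ℕ) (α₁ α₂ α₃ : Dual ℝ A),
      KVbr2 mul ((N ^ k) ∘ₗ Hs) ((N ^ l) ∘ₗ Hs) α₁ α₂ α₃ = 0) := by
  have hc := compat_all mul Hs N h
  refine ⟨fun k α₁ α₂ α₃ => ?_, hc⟩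
  have e := hc k k α₁ α₂ α₃
  simp only [KVbr2, KVbr] at e ⊢
  linarith
end

section
/- Let H and H₁ be Koszul-Vinberg structures on a left-symmetric algebra A with H^♯: A* → A bijective. If H and H₁ are compatible (⟦H,H₁⟧ = 0), then N := H₁^♯∘(H^♯)⁻¹ is a Nijenhuis operator on A, and both (H, N) and (H₁, N) are KVN-structures. -/
open Module

variable {A : Type*} [AddCommGroup A] [Module ℝ A] [FiniteDimensional ℝ A]

/-- if `H`, `H₁` are compatible KV structures and `H^♯` is
bijective (witnessed by the two-sided inverse `K`), then
`N := H₁^♯∘(H^♯)⁻¹` is Nijenhuis and `(H,N)`, `(H₁,N)` are KVN-structures. -/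
theorem KVN_of_compatible_KV
    (mul : A →ₗ[ℝ] A →ₗ[ℝ] A) (hls : IsLS mul)
    (Hs H1s : Dual ℝ A →ₗ[ℝ] A) (hsym : IsSymmT Hs) (hsym1 : IsSymmT H1s)
    (hkv : IsKV mul Hs) (hkv1 : IsKV mul H1s)
    (K : A →ₗ[ℝ] Dual ℝ A) (hK1 : ∀ x : A, Hs (K x) = x)
    (hK2 : ∀ α : Dual ℝ A, K (Hs α) = α)
    (hcomp : ∀ α₁ α₂ α₃ : Dual ℝ A, KVbr2 mul Hs H1s α₁ α₂ α₃ = 0) :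
    IsNij mul (H1s ∘ₗ K) ∧ IsKVN mul Hs (H1s ∘ₗ K) ∧ IsKVN mul H1s (H1s ∘ₗ K) := by
  obtain ⟨N, hN⟩ : ∃ N : A →ₗ[ℝ] A, N = H1s ∘ₗ K := ⟨_, rfl⟩
  have hNK : ∀ x, H1s (K x) = N x := fun x => by rw [hN]; rfl
  rw [← hN]
  have hB : ∀ x y, K x y = K y x := fun x y => by
    have := hsym (K x) (K y)
    rwa [hK1, hK1] at this
  have hBN : ∀ x y, K x (N y) = K (N x) y := fun x y => by
    have := hsym1 (K x) (K y)
    rw [hNK, hNK] at this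
    rw [this, hB]
  have c0 : ∀ x y z, K x (mul y z) - K y (mul x z) - (K z (mul x y) - K z (mul y x)) = 0 :=
    fun x y z => by
      have := hkv (K x) (K y) (K z)
      simpa only [KVbr, br, hK1, map_sub] using this
  have c1 : ∀ x y z, K x (mul (N y) (N z)) - K y (mul (N x) (N z))
      - (K z (mul (N x) (N y)) - K z (mul (N y) (N x))) = 0 :=
    fun x y z => by
      have := hkv1 (K x) (K y) (K z)
      simpa only [KVbr, br, hNK, map_sub] using this
  have c2 : ∀ x y z, K x (mul y (N z)) + K x (mul (N y) z) - K y (mul x (N z))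
      - K y (mul (N x) z) - (K z (mul x (N y)) - K z (mul (N y) x))
      - (K z (mul (N x) y) - K z (mul y (N x))) = 0 :=
    fun x y z => by
      have := hcomp (K x) (K y) (K z)
      simp only [KVbr2, br, hK1, hNK, map_sub] at this
      linarith
  have hdm : ∀ x, N.dualMap (K x) = K (N x) := fun x => by
    ext y
    rw [LinearMap.dualMap_apply, hBN]
  have hsurj : ∀ α : Dual ℝ A, ∃ x, α = K x := fun α => ⟨Hs α, (hK2 α).symm⟩
  have hinj : ∀ x y : A, (∀ w, K w x = K w y) → x = y := fun x y h => by
    rw [← hK1 x, ← hK1 y]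
    congr 1
    ext w
    rw [hB, h, hB]
  have hNij : IsNij mul N := by
    intro x y
    apply hinj
    intro w
    simp only [map_add, map_sub, hBN]
    linarith [c1 x w y, c2 x (N w) y, c0 x (N w) (N y), c0 (N x) (N w) y, c0 x (N (N w)) y,
      hBN y (mul x (N w)), hBN y (mul (N w) x)]
  refine ⟨hNij, ⟨hkv, hNij, ?_, ?_⟩, ⟨hkv1, hNij, ?_, ?_⟩⟩
  · ext α
    obtain ⟨x, rfl⟩ := hsurj α
    simp only [LinearMap.comp_apply, hdm, hK1]
  · intro α β
    obtain ⟨x, rfl⟩ := hsurj α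
    obtain ⟨y, rfl⟩ := hsurj β
    ext z
    simp only [dualMul, dmulE, mulN, hdm, hK1, LinearMap.add_apply, LinearMap.sub_apply,
      LinearMap.neg_apply, LinearMap.comp_apply, LinearMap.flip_apply, LinearMap.llcomp_apply,
      LinearMap.dualMap_apply, map_add, map_sub, hBN]
    linarith [c2 x z y, c0 x z (N y), c0 (N x) z y, c0 x (N z) y]
  · ext α
    obtain ⟨x, rfl⟩ := hsurj α
    simp only [LinearMap.comp_apply, hdm, hNK]
  · intro α β
    obtain ⟨x, rfl⟩ := hsurj α
    obtain ⟨y, rfl⟩ := hsurj β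
    ext z
    simp only [dualMul, dmulE, mulN, hdm, hNK, LinearMap.add_apply, LinearMap.sub_apply,
      LinearMap.neg_apply, LinearMap.comp_apply, LinearMap.flip_apply, LinearMap.llcomp_apply,
      LinearMap.dualMap_apply, map_add, map_sub, hBN]
    linarith [c1 x z y, c0 (N x) z (N y)]
end

section
/- Let H and H₁ be Koszul-Vinberg structures on a left-symmetric algebra A with both H^♯ and H₁^♯ bijective. If N := H₁^♯∘(H^♯)⁻¹ is a Nijenhuis operator on A, then H and H₁ are compatible: ⟦H, H₁⟧ = 0. -/
open Module

variable {A : Type*} [AddCommGroup A] [Module ℝ A] [FiniteDimensional ℝ A]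

/-- if `H`, `H₁` are KV structures with both `H^♯` and `H₁^♯`
bijective and `N := H₁^♯∘(H^♯)⁻¹` is Nijenhuis, then `H` and `H₁` are
compatible. -/
theorem compatible_of_Nijenhuis
    (mul : A →ₗ[ℝ] A →ₗ[ℝ] A) (hls : IsLS mul)
    (Hs H1s : Dual ℝ A →ₗ[ℝ] A) (hsym : IsSymmT Hs) (hsym1 : IsSymmT H1s)
    (hkv : IsKV mul Hs) (hkv1 : IsKV mul H1s)
    (K : A →ₗ[ℝ] Dual ℝ A) (hK1 : ∀ x : A, Hs (K x) = x)
    (hK2 : ∀ α : Dual ℝ A, K (Hs α) = α)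
    (hbij1 : Function.Bijective ⇑H1s)
    (hNij : IsNij mul (H1s ∘ₗ K)) :
    ∀ α₁ α₂ α₃ : Dual ℝ A, KVbr2 mul Hs H1s α₁ α₂ α₃ = 0 := by
  intro α₁ α₂ α₃
  obtain ⟨β, hβ⟩ := hbij1.2 (Hs α₁)
  have key : ∀ w : A, β (H1s (K w)) = α₁ w := by
    intro w
    rw [hsym1, hβ, hsym, hK1]
  have key2 : ∀ w : A, K (H1s α₁) w = α₁ (H1s (K w)) := by
    intro w
    conv_lhs => rw [← hK1 w]
    rw [hsym, hK1, hsym1]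
  have h1 := hkv1 β α₂ α₃
  have h2 := hkv (K (H1s α₁)) α₂ α₃
  have h3 := congrArg β (hNij (Hs α₂) (Hs α₃))
  simp only [LinearMap.comp_apply, hK2] at h3
  rw [key] at h3
  simp only [KVbr, br, hK1, key2, hβ, map_sub] at h1 h2
  simp only [map_add, map_sub] at h3
  simp only [KVbr2, br, map_sub]
  linarith
end

section
/- Let (H,N) be a KVN-structure on a left-symmetric algebra A with H^♯: A* → A bijective. Then for every k ∈ ℕ, (H, N^k) is a KVN-structure, and (H_{N^k}, N^k) is a KVN-structure, where H_{N^k} is the symmetric 2-tensor with (H_{N^k})^♯ := N^k∘H^♯. -/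
open Module

variable {A : Type*} [AddCommGroup A] [Module ℝ A] [FiniteDimensional ℝ A]

/-- Cocycle condition with the products in the second slot. -/
def CocAux {A : Type*} [AddCommGroup A] [Module ℝ A]
    (mul : A →ₗ[ℝ] A →ₗ[ℝ] A) (B : A →ₗ[ℝ] Dual ℝ A) (P : A →ₗ[ℝ] A) : Prop :=
  ∀ x y z : A, B (P x) (mul y z) - B (P y) (mul x z) - B (P z) (mul x y)
    + B (P z) (mul y x) = 0

theorem mulN_apply_aux {A : Type*} [AddCommGroup A] [Module ℝ A]
    (mul : A →ₗ[ℝ] A →ₗ[ℝ] A) (N : A →ₗ[ℝ] A) (x y : A) :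
    mulN mul N x y = mul (N x) y + mul x (N y) - N (mul x y) := by
  simp [mulN]

theorem dualMul_apply_aux {A : Type*} [AddCommGroup A] [Module ℝ A]
    (mul : A →ₗ[ℝ] A →ₗ[ℝ] A) (Hs : Dual ℝ A →ₗ[ℝ] A) (α β : Dual ℝ A) (y : A) :
    dualMul mul Hs α β y
      = -(β (mul (Hs α) y) - β (mul y (Hs α))) + α (mul y (Hs β)) := by
  simp [dualMul]

theorem nij_one_pow {A : Type*} [AddCommGroup A] [Module ℝ A]
    (mul : A →ₗ[ℝ] A →ₗ[ℝ] A) (N : A →ₗ[ℝ] A) (h : IsNij mul N) (j : ℕ) (x y : A) :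
    mul (N x) ((N ^ j) y) = N (mul x ((N ^ j) y)) + (N ^ j) (mul (N x) y)
      - N ((N ^ j) (mul x y)) := by
  induction j with
  | zero => simp
  | succ j ih =>
    have h1 := h x ((N ^ j) y)
    simp only [pow_succ', Module.End.mul_apply]
    rw [h1, ih]
    simp only [map_add, map_sub]
    abel

theorem nij_pow_pow {A : Type*} [AddCommGroup A] [Module ℝ A]
    (mul : A →ₗ[ℝ] A →ₗ[ℝ] A) (N : A →ₗ[ℝ] A) (h : IsNij mul N) (j i : ℕ) (x y : A) :
    mul ((N ^ i) x) ((N ^ j) y) = (N ^ i) (mul x ((N ^ j) y)) + (N ^ j) (mul ((N ^ i) x) y)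
      - (N ^ i) ((N ^ j) (mul x y)) := by
  have comm : ∀ v, (N ^ j) (N v) = N ((N ^ j) v) := fun v => by
    rw [← Module.End.mul_apply, ← Module.End.mul_apply, ← pow_succ, ← pow_succ']
  induction i with
  | zero => simp
  | succ i ih =>
    have h1 := nij_one_pow mul N h j ((N ^ i) x) y
    simp only [pow_succ' N i, Module.End.mul_apply]
    rw [h1, ih]
    simp only [map_add, map_sub, comm]
    abel

theorem nij_pow_s13 {A : Type*} [AddCommGroup A] [Module ℝ A]
    (mul : A →ₗ[ℝ] A →ₗ[ℝ] A) (N : A →ₗ[ℝ] A) (h : IsNij mul N) (k : ℕ) :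
    IsNij mul (N ^ k) := by
  intro x y
  rw [nij_pow_pow mul N h k k x y]
  simp only [map_add, map_sub]
  abel

/-- If `C` and `C_N` are cocycles then so is `C_{N²}`. -/
theorem coc_step {A : Type*} [AddCommGroup A] [Module ℝ A]
    (mul : A →ₗ[ℝ] A →ₗ[ℝ] A) (B : A →ₗ[ℝ] Dual ℝ A) (N P : A →ₗ[ℝ] A)
    (h : IsNij mul N) (adj : ∀ x y, B x (N y) = B (N x) y)
    (comm : ∀ v, N (P v) = P (N v))
    (h0 : CocAux mul B P) (h1 : CocAux mul B (P * N)) : CocAux mul B (P * N * N) := by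
  intro x y z
  have a := h1 (N x) y z
  have b := h1 x (N y) z
  have c := h0 (N x) (N y) z
  rw [h x y, h y x] at c
  simp only [Module.End.mul_apply, map_add, map_sub, adj, comm] at *
  linarith

theorem coc_pow {A : Type*} [AddCommGroup A] [Module ℝ A]
    (mul : A →ₗ[ℝ] A →ₗ[ℝ] A) (B : A →ₗ[ℝ] Dual ℝ A) (N : A →ₗ[ℝ] A)
    (h : IsNij mul N) (adj : ∀ x y, B x (N y) = B (N x) y)
    (h0 : CocAux mul B 1) (h1 : CocAux mul B N) (k : ℕ) :
    CocAux mul B (N ^ k) ∧ CocAux mul B (N ^ (k + 1)) := by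
  induction k with
  | zero => simpa using ⟨h0, h1⟩
  | succ k ih =>
    refine ⟨ih.2, ?_⟩
    have := coc_step mul B N (N ^ k) h adj (fun v => by
      rw [← Module.End.mul_apply, ← Module.End.mul_apply, ← pow_succ, ← pow_succ'])
      ih.1 (by rw [← pow_succ]; exact ih.2)
    rwa [← pow_succ, ← pow_succ] at this

/-- if `(H,N)` is a KVN-structure with `H^♯` bijective, then
for every `k`, `(H, N^k)` and `(H_{N^k}, N^k)` are KVN-structures. -/
theorem KVN_powers
    (mul : A →ₗ[ℝ] A →ₗ[ℝ] A) (hls : IsLS mul)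
    (Hs : Dual ℝ A →ₗ[ℝ] A) (hsym : IsSymmT Hs)
    (N : A →ₗ[ℝ] A) (h : IsKVN mul Hs N)
    (hbij : Function.Bijective ⇑Hs) :
    ∀ k : ℕ, IsKVN mul Hs (N ^ k) ∧ IsKVN mul ((N ^ k) ∘ₗ Hs) (N ^ k) := by
  obtain ⟨hKV, hN, hNH, hstar⟩ := h
  obtain ⟨B, hHB, hBH⟩ : ∃ B : A →ₗ[ℝ] Dual ℝ A, (∀ x, Hs (B x) = x) ∧ ∀ α, B (Hs α) = α :=
    ⟨(LinearEquiv.ofBijective Hs hbij).symm,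
      fun x => (LinearEquiv.ofBijective Hs hbij).apply_symm_apply x,
      fun x => (LinearEquiv.ofBijective Hs hbij).symm_apply_apply x⟩
  have surj : ∀ α, ∃ x, α = B x := fun α => ⟨Hs α, (hBH α).symm⟩
  have sym : ∀ x y, B x y = B y x := fun x y => by
    have := hsym (B x) (B y)
    rwa [hHB, hHB] at this
  have hdual : ∀ x, N.dualMap (B x) = B (N x) := fun x => by
    have := congrArg B (LinearMap.congr_fun hNH (B x))
    simp only [LinearMap.comp_apply, hHB, hBH] at this
    exact this.symm
  have adj : ∀ x y, B x (N y) = B (N x) y := fun x y => by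
    rw [← hdual]; rfl
  have c0 : CocAux mul B 1 := fun x y z => by
    have := hKV (B x) (B y) (B z)
    simp only [KVbr, br, hHB, map_sub] at this
    simp only [Module.End.one_apply]
    linarith
  have c1 : CocAux mul B N := fun x y z => by
    have e := LinearMap.congr_fun (hstar (B x) (B z)) y
    simp only [dmulE, LinearMap.sub_apply, LinearMap.add_apply, hdual,
      LinearMap.dualMap_apply, dualMul_apply_aux, hHB, mulN_apply_aux, map_add, map_sub,
      adj] at e
    have a1 := c0 x (N y) z
    have a2 := c0 (N x) y z
    have a3 := c0 x y (N z)
    simp only [Module.End.one_apply] at *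
    linarith
  intro k
  have hM := nij_pow_s13 mul N hN k
  have d1 : CocAux mul B (N ^ k) := (coc_pow mul B N hN adj c0 c1 k).1
  have d2 : CocAux mul B (N ^ k * N ^ k) := by
    rw [← pow_add]; exact (coc_pow mul B N hN adj c0 c1 (k + k)).1
  have adjM : ∀ x y, B x ((N ^ k) y) = B ((N ^ k) x) y := by
    clear hM d1 d2
    induction k with
    | zero => simp
    | succ k ih =>
      intro x y
      rw [pow_succ', Module.End.mul_apply, adj, ih, ← Module.End.mul_apply, ← pow_succ, pow_succ']
  generalize N ^ k = M at *
  have hdM : ∀ x, M.dualMap (B x) = B (M x) := fun x => by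
    ext y
    exact adjM x y
  have hMH : M ∘ₗ Hs = Hs ∘ₗ M.dualMap := by
    ext α
    obtain ⟨x, rfl⟩ := surj α
    simp only [LinearMap.comp_apply, hdM, hHB]
  have c0' : ∀ x y z : A, B x (mul y z) - B y (mul x z) - B z (mul x y)
    + B z (mul y x) = 0 := c0
  have d2' : ∀ x y z : A, B (M (M x)) (mul y z) - B (M (M y)) (mul x z)
    - B (M (M z)) (mul x y) + B (M (M z)) (mul y x) = 0 := d2
  refine ⟨⟨hKV, hM, hMH, ?_⟩, ?_, hM, ?_, ?_⟩
  · intro α β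
    obtain ⟨x, rfl⟩ := surj α
    obtain ⟨z, rfl⟩ := surj β
    ext y
    simp only [dmulE, LinearMap.sub_apply, LinearMap.add_apply, hdM,
      LinearMap.dualMap_apply, dualMul_apply_aux, hHB, mulN_apply_aux, map_add, map_sub,
      adjM]
    have a1 := c0' x (M y) z
    have a2 := c0' (M x) y z
    have a3 := c0' x y (M z)
    have a4 := d1 x y z
    linarith
  · intro α β γ
    obtain ⟨x, rfl⟩ := surj α
    obtain ⟨y, rfl⟩ := surj β
    obtain ⟨z, rfl⟩ := surj γ
    simp only [KVbr, br, LinearMap.comp_apply, hHB, map_sub]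
    have a1 := c0' (M x) (M y) z
    have a2 := d1 x y (M z)
    have a3 := d2' x y z
    rw [hM x y, hM y x] at a1 ⊢
    rw [hM y z, hM x z]
    simp only [map_add, map_sub, adjM] at *
    linarith
  · rw [LinearMap.comp_assoc, ← hMH]
  · intro α β
    obtain ⟨x, rfl⟩ := surj α
    obtain ⟨z, rfl⟩ := surj β
    ext y
    simp only [dmulE, LinearMap.sub_apply, LinearMap.add_apply, hdM, LinearMap.comp_apply,
      LinearMap.dualMap_apply, dualMul_apply_aux, hHB, mulN_apply_aux, map_add, map_sub,
      adjM]
    have a1 := c0' x (M y) (M z)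
    have a2 := c0' (M x) y (M z)
    have a3 := d2' x y z
    have a4 := d1 (M x) y z
    have n1 := congrArg (B z) (hM x y)
    have n2 := congrArg (B z) (hM y x)
    have n3 := congrArg (B y) (hM x z)
    simp only [map_add, map_sub, adjM] at *
    linarith
end

section
/- Let H be a Koszul-Vinberg structure and 𝔅 a symmetric bilinear form on a left-symmetric algebra A. Then (H, 𝔅) is a KVB-structure if and only if 𝔅 is a 2-cocycle that is complementary for H. -/
open Module

variable {A : Type*} [AddCommGroup A] [Module ℝ A] [FiniteDimensional ℝ A]

/-- `(H,𝔅)` is a KVB-structure iff `𝔅` is a 2-cocycle that is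
complementary for `H`. -/
theorem KVB_iff_cocycle_complementary
    (mul : A →ₗ[ℝ] A →ₗ[ℝ] A) (hls : IsLS mul)
    (Hs : Dual ℝ A →ₗ[ℝ] A) (hsym : IsSymmT Hs) (hkv : IsKV mul Hs)
    (B : A →ₗ[ℝ] Dual ℝ A) (hsymB : IsSymmB B) :
    IsKVB mul Hs B ↔ (IsCocycle mul B ∧ IsComplementary mul Hs B) := by
  have key : IsCocycle mul B → ∀ x y z : A,
      (B ∘ₗ (Hs ∘ₗ B)) x (mul y z) - (B ∘ₗ (Hs ∘ₗ B)) y (mul x z)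
        - (B ∘ₗ (Hs ∘ₗ B)) (br mul x y) z =
      -B (mul ((Hs ∘ₗ B) y) z) x - B (mul y ((Hs ∘ₗ B) z)) x
      + B (mul ((Hs ∘ₗ B) x) z) y + B (mul x ((Hs ∘ₗ B) z)) y
      + B (br mul ((Hs ∘ₗ B) x) y) z - B (br mul ((Hs ∘ₗ B) y) x) z := by
    intro hc x y z
    have h1 := hc (Hs (B x)) y z
    have h2 := hc x (Hs (B y)) z
    have h3 := hc x y (Hs (B z))
    have hT : B (Hs (B (br mul x y))) z = B (br mul x y) (Hs (B z)) := by
      rw [hsymB (Hs (B (br mul x y))) z]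
      exact hsym _ _
    have hb : br mul x (Hs (B y)) = -br mul (Hs (B y)) x := by
      simp [br]
    rw [hb, map_neg, LinearMap.neg_apply] at h2
    simp only [LinearMap.comp_apply]
    rw [hT, hsymB (mul (Hs (B y)) z) x, hsymB (mul y (Hs (B z))) x,
      hsymB (mul (Hs (B x)) z) y, hsymB (mul x (Hs (B z))) y]
    linarith
  constructor
  · rintro ⟨_, hc, hn⟩
    exact ⟨hc, fun x y z => (key hc x y z).symm.trans (hn x y z)⟩
  · rintro ⟨hc, hn⟩
    exact ⟨hsymB, hc, fun x y z => (key hc x y z).trans (hn x y z)⟩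
end

section
/- Let H be a Koszul-Vinberg structure on a left-symmetric algebra A and 𝔅 a symmetric bilinear form on A. Then 𝔅 is a 2-cocycle that is complementary for H if and only if both of the following hold for all x, y, z ∈ A, where T := H^♯∘𝔅^♮: (a) 𝔅(x·y, z) = 𝔅(x, z·y) − 𝔅(y, [x,z]); (b) (𝔅^♮(x) ·^H 𝔅^♮(y))(z) = 𝔅(T(x)·y + x·T(y) − T(x·y), z). -/
open Module

variable {A : Type*} [AddCommGroup A] [Module ℝ A] [FiniteDimensional ℝ A]

/-- `𝔅` is a 2-cocycle complementary for `H` iff (a)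
`𝔅(x·y, z) = 𝔅(x, z·y) − 𝔅(y, [x,z])` and (b)
`(𝔅^♮x ·^H 𝔅^♮y)(z) = 𝔅(T(x)·y + x·T(y) − T(x·y), z)` with `T = H^♯∘𝔅^♮`. -/
theorem cocycle_complementary_iff
    (mul : A →ₗ[ℝ] A →ₗ[ℝ] A) (hls : IsLS mul)
    (Hs : Dual ℝ A →ₗ[ℝ] A) (hsym : IsSymmT Hs) (hkv : IsKV mul Hs)
    (B : A →ₗ[ℝ] Dual ℝ A) (hsymB : IsSymmB B) :
    (IsCocycle mul B ∧ IsComplementary mul Hs B) ↔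
    ((∀ x y z : A, B (mul x y) z = B x (mul z y) - B y (br mul x z)) ∧
     (∀ x y z : A,
        dualMul mul Hs (B x) (B y) z
          = B (mul ((Hs ∘ₗ B) x) y + mul x ((Hs ∘ₗ B) y)
              - (Hs ∘ₗ B) (mul x y)) z)) := by
  have hT : ∀ u v : A, B (Hs (B u)) v = B u (Hs (B v)) := fun u v => by
    rw [hsymB (Hs (B u)) v, hsym (B v) (B u)]
  have key : IsCocycle mul B → ∀ x y z : A,
      (dualMul mul Hs (B x) (B y) z
          - B (mul ((Hs ∘ₗ B) x) y + mul x ((Hs ∘ₗ B) y)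
              - (Hs ∘ₗ B) (mul x y)) z) =
      -(-B (mul ((Hs ∘ₗ B) z) y) x - B (mul z ((Hs ∘ₗ B) y)) x
        + B (mul ((Hs ∘ₗ B) x) y) z + B (mul x ((Hs ∘ₗ B) y)) z
        + B (br mul ((Hs ∘ₗ B) x) z) y - B (br mul ((Hs ∘ₗ B) z) x) y) := by
    intro hc x y z
    have e1 := hc (Hs (B z)) x y
    have e2 := hT (mul x y) z
    simp only [dualMul, br, LinearMap.comp_apply, LinearMap.add_apply, LinearMap.sub_apply,
      LinearMap.neg_apply, LinearMap.flip_apply, map_add, map_sub] at *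
    have s1 := hsymB (Hs (B z)) (mul x y)
    have s2 := hsymB x (mul (Hs (B z)) y)
    have s3 := hsymB x (mul z (Hs (B y)))
    have s4 := hsymB y (mul (Hs (B x)) z)
    have s5 := hsymB y (mul z (Hs (B x)))
    linarith
  have ha : IsCocycle mul B ↔
      ∀ x y z : A, B (mul x y) z = B x (mul z y) - B y (br mul x z) := by
    constructor
    · intro h x y z
      have := h x z y
      rw [hsymB (mul x y) z, hsymB y]
      linarith
    · intro h x y z
      have := h x z y
      rw [hsymB (mul x z) y, hsymB z] at this
      linarith
  constructor
  · rintro ⟨h1, h2⟩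
    refine ⟨ha.1 h1, fun x y z => ?_⟩
    have k := key h1 x y z
    rw [h2 x z y] at k
    linarith
  · rintro ⟨h1, h2⟩
    refine ⟨ha.2 h1, fun x y z => ?_⟩
    have k := key (ha.2 h1) x z y
    have := h2 x z y
    linarith
end

section
/- If (H, 𝔅) is a KVB-structure on a left-symmetric algebra A, then (H, N) with N := H^♯∘𝔅^♮ is a KVN-structure. Conversely, if (H, N) is a KVN-structure with H^♯: A* → A bijective, then (H, 𝔅) is a KVB-structure, where 𝔅 is the symmetric bilinear form defined by 𝔅^♮ := (H^♯)⁻¹∘N, i.e. 𝔅(x,y) := ((H^♯)⁻¹(N(x)))(y). -/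
open Module

variable {A : Type*} [AddCommGroup A] [Module ℝ A] [FiniteDimensional ℝ A]

theorem cond_iff (mul : A →ₗ[ℝ] A →ₗ[ℝ] A) (Hs : Dual ℝ A →ₗ[ℝ] A) (N : A →ₗ[ℝ] A)
    (h : ∀ α : Dual ℝ A, Hs (N.dualMap α) = N (Hs α)) (α β : Dual ℝ A) (y : A) :
    dualMul (mulN mul N) Hs α β y - dmulE mul Hs N.dualMap α β y =
      2 * (β (N (mul (Hs α) y)) - β (N (mul y (Hs α))) - β (mul (Hs α) (N y))
        + β (mul (N y) (Hs α)) + α (mul (N y) (Hs β)) - α (N (mul y (Hs β)))) := by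
  simp only [dualMul, dmulE, mulN, h, LinearMap.add_apply, LinearMap.sub_apply,
    LinearMap.neg_apply, LinearMap.comp_apply, LinearMap.flip_apply, LinearMap.llcomp_apply,
    LinearMap.dualMap_apply, map_add, map_sub]
  ring

/-- a KVB-structure `(H,𝔅)` gives the KVN-structure
`(H, H^♯∘𝔅^♮)`; conversely a KVN-structure `(H,N)` with `H^♯` bijective
(with two-sided inverse `K`) gives the KVB-structure `(H, 𝔅)` with
`𝔅^♮ = (H^♯)⁻¹∘N`. -/
theorem KVB_iff_KVN
    (mul : A →ₗ[ℝ] A →ₗ[ℝ] A) (hls : IsLS mul)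
    (Hs : Dual ℝ A →ₗ[ℝ] A) (hsym : IsSymmT Hs) (hkv : IsKV mul Hs) :
    (∀ B : A →ₗ[ℝ] Dual ℝ A, IsKVB mul Hs B → IsKVN mul Hs (Hs ∘ₗ B)) ∧
    (∀ (N : A →ₗ[ℝ] A) (K : A →ₗ[ℝ] Dual ℝ A),
      (∀ x : A, Hs (K x) = x) → (∀ α : Dual ℝ A, K (Hs α) = α) →
      IsKVN mul Hs N → IsKVB mul Hs (K ∘ₗ N)) := by
  constructor
  · rintro B ⟨hs, hc, hcN⟩
    have hd : ∀ α : Dual ℝ A, (Hs ∘ₗ B).dualMap α = B (Hs α) := by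
      intro α
      ext x
      rw [LinearMap.dualMap_apply, LinearMap.comp_apply, hsym, hs]
    have h1 : ∀ α : Dual ℝ A, Hs ((Hs ∘ₗ B).dualMap α) = (Hs ∘ₗ B) (Hs α) := by
      intro α
      rw [hd]; rfl
    have hp : ∀ (α : Dual ℝ A) (x : A), α (Hs (B x)) = B (Hs α) x := by
      intro α x
      rw [hsym, hs]
    refine ⟨hkv, ?_, ?_, ?_⟩
    · intro x y
      rw [← sub_eq_zero, ← Module.forall_dual_apply_eq_zero_iff ℝ]
      intro β
      have e1 := hkv β (B x) (B y)
      have e2 := hc (Hs β) (Hs (B x)) y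
      have e3 := hc (Hs β) x (Hs (B y))
      have e4 := hcN (Hs β) x y
      have s1 := hp (B (Hs β)) (mul x y)
      have s2 := hs y (mul (Hs β) (Hs (B x)))
      have s3 := hs y (mul (Hs (B x)) (Hs β))
      have s4 := hp (B (mul (Hs β) x)) y
      have s5 := hp (B (mul x (Hs β))) y
      simp only [KVbr, br, LinearMap.comp_apply, map_sub, map_add, LinearMap.sub_apply, hp]
        at *
      linarith
    · ext α : 1
      exact (h1 α).symm
    · intro α β
      ext y
      rw [← sub_eq_zero, cond_iff mul Hs _ h1]
      have e1 := hkv α (B y) β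
      have e2 := hc (Hs α) y (Hs β)
      have s1 := hs (Hs β) (mul (Hs α) y)
      have s2 := hs (Hs β) (mul y (Hs α))
      simp only [KVbr, br, LinearMap.comp_apply, map_sub, map_add, LinearMap.sub_apply, hp]
        at *
      linarith
  · rintro N K hHK hKH ⟨-, hN, hNH, hD⟩
    have h1 : ∀ α : Dual ℝ A, Hs (N.dualMap α) = N (Hs α) := fun α =>
      (LinearMap.congr_fun hNH α).symm
    have hKs : ∀ x y : A, K x y = K y x := by
      intro x y
      have := hsym (K x) (K y)
      rwa [hHK, hHK] at this
    have hNK : ∀ x y : A, K (N x) y = K x (N y) := by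
      intro x y
      have := h1 (K x)
      rw [hHK] at this
      rw [← this, hKH]; rfl
    have hc : IsCocycle mul (K ∘ₗ N) := by
      intro x y z
      have e0 := cond_iff mul Hs N h1 (K x) (K z) y
      rw [hD, sub_self] at e0
      have e1 := hkv (K x) (K (N y)) (K z)
      have s1 := hKs z (N (mul x y))
      have s2 := hKs z (N (mul y x))
      simp only [KVbr, br, LinearMap.comp_apply, map_sub, map_add, LinearMap.sub_apply, hHK]
        at *
      have s3 := hNK x (mul y z)
      linarith
    refine ⟨?_, hc, ?_⟩
    · intro x y
      change K (N x) y = K (N y) x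
      rw [hNK, hKs]
    · intro u x y
      have e0 := congrArg (K u) (hN x y)
      have e1 := hkv (K u) (K (N x)) (K (N y))
      have e2 := hc u (N x) y
      have e3 := hc u x (N y)
      have s1 := (hKs (mul u (N x)) (N y)).trans (hNK y (mul u (N x)))
      have s2 := (hKs (mul (N x) u) (N y)).trans (hNK y (mul (N x) u))
      simp only [KVbr, br, LinearMap.comp_apply, map_sub, map_add, LinearMap.sub_apply, hHK,
        hNK] at *
      linarith
end

section
/- If (𝔅, N) is a pseudo-Hessian-Nijenhuis (HN-)structure on a left-symmetric algebra A with 𝔅^♮: A → A* bijective, then (H, N) is a KVN-structure, where H is the symmetric 2-tensor with H^♯ := (𝔅^♮)⁻¹. Conversely, if (H, N) is a KVN-structure with H^♯ bijective, then (𝔅, N) is an HN-structure, where 𝔅(x,y) := ((H^♯)⁻¹(x))(y). -/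
open Module

variable {A : Type*} [AddCommGroup A] [Module ℝ A] [FiniteDimensional ℝ A]

/-- For `α = B x`, `β = B y`, the difference of the two deformed dual products is twice
the cocycle defect of `B ∘ N`. -/
theorem key_identity (mul : A →ₗ[ℝ] A →ₗ[ℝ] A) (B : A →ₗ[ℝ] Dual ℝ A) (N : A →ₗ[ℝ] A)
    (K : Dual ℝ A →ₗ[ℝ] A) (hKB : ∀ x : A, K (B x) = x)
    (hs : IsSymmB B) (hc : IsCocycle mul B) (hN : ∀ x y : A, B (N x) y = B x (N y))
    (x y z : A) :
    dualMul (mulN mul N) K (B x) (B y) z - dmulE mul K N.dualMap (B x) (B y) z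
      = -2 * ((B ∘ₗ N) x (mul z y) - (B ∘ₗ N) z (mul x y) - (B ∘ₗ N) (br mul x z) y) := by
  have hd : ∀ x, N.dualMap (B x) = B (N x) := by
    intro x; ext w; simp [hN]
  have h1 := hc x (N z) y
  have e1 := hs y (mul x (N z))
  have e2 := hs y (mul (N z) x)
  have e3 := hN y (mul x z)
  have e4 := hN y (mul z x)
  have e5 := hs y (N (mul x z))
  have e6 := hs y (N (mul z x))
  have e7 := hN x (mul z y)
  have e8 := hN z (mul x y)
  simp only [dmulE, hd]
  simp only [dualMul, mulN, br, hKB, LinearMap.add_apply, LinearMap.sub_apply,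
    LinearMap.neg_apply, LinearMap.comp_apply, LinearMap.flip_apply, LinearMap.dualMap_apply,
    LinearMap.llcomp_apply, map_sub, map_add] at *
  linarith

/-- an HN-structure `(𝔅,N)` with `𝔅^♮` bijective (two-sided
inverse `K = (𝔅^♮)⁻¹`) gives the KVN-structure `(H,N)` with `H^♯ = (𝔅^♮)⁻¹`;
conversely a KVN-structure `(H,N)` with `H^♯` bijective (two-sided inverse
`K`) gives the HN-structure `(𝔅,N)` with `𝔅^♮ = (H^♯)⁻¹`. -/
theorem HN_iff_KVN
    (mul : A →ₗ[ℝ] A →ₗ[ℝ] A) (hls : IsLS mul) :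
    (∀ (B : A →ₗ[ℝ] Dual ℝ A) (N : A →ₗ[ℝ] A) (K : Dual ℝ A →ₗ[ℝ] A),
      (∀ x : A, K (B x) = x) → (∀ α : Dual ℝ A, B (K α) = α) →
      IsHN mul B N → IsKVN mul K N) ∧
    (∀ (Hs : Dual ℝ A →ₗ[ℝ] A) (N : A →ₗ[ℝ] A) (K : A →ₗ[ℝ] Dual ℝ A),
      IsSymmT Hs → (∀ x : A, Hs (K x) = x) → (∀ α : Dual ℝ A, K (Hs α) = α) →
      IsKVN mul Hs N → IsHN mul K N) := by
  constructor
  · rintro B N K hKB hBK ⟨hs, hc, hNij, hN, hcN⟩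
    refine ⟨?_, hNij, ?_, ?_⟩
    · intro a b c
      have h := hc (K a) (K b) (K c)
      rw [hs (br mul (K a) (K b)) (K c)] at h
      simpa only [hBK, KVbr] using h
    · ext a
      have h : B (N (K a)) = N.dualMap a := by
        ext w
        rw [hN, hBK, LinearMap.dualMap_apply]
      rw [LinearMap.comp_apply, LinearMap.comp_apply, ← h, hKB]
    · intro a b
      ext z
      have h := key_identity mul B N K hKB hs hc hN (K a) (K b) z
      rw [hcN, hBK, hBK] at h
      linarith
  · rintro Hs N K hS hHK hKH ⟨hkv, hNij, hcomm, hd⟩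
    have hs : IsSymmB K := by
      intro x y
      have h := hS (K x) (K y)
      rwa [hHK, hHK] at h
    have hc : IsCocycle mul K := by
      intro x y z
      have h := hkv (K x) (K y) (K z)
      rw [hs (br mul x y) z]
      simpa only [hHK, KVbr] using h
    have hN : ∀ x y : A, K (N x) y = K x (N y) := by
      intro x y
      have h := LinearMap.congr_fun hcomm (K x)
      rw [LinearMap.comp_apply, LinearMap.comp_apply, hHK] at h
      rw [h, hKH, LinearMap.dualMap_apply]
    refine ⟨hs, hc, hNij, hN, ?_⟩
    intro x z y
    have h := key_identity mul K N Hs hHK hs hc hN x y z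
    rw [hd] at h
    linarith
end

section
/- Let 𝔅 be a pseudo-Hessian structure on a left-symmetric algebra A with 𝔅^♮: A → A* bijective, and let N: A → A be a linear map satisfying 𝔅(N(x), y) = 𝔅(x, N(y)) for all x, y ∈ A. Then (𝔅, N) is a pseudo-Hessian-Nijenhuis (HN-)structure — in particular N is a Nijenhuis operator — if and only if the bilinear forms 𝔅_N(x,y) := 𝔅(N(x), y) and 𝔅_{N²}(x,y) := 𝔅(N(N(x)), y) are both 2-cocycles. -/
open Module

variable {A : Type*} [AddCommGroup A] [Module ℝ A] [FiniteDimensional ℝ A]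

/-- for a pseudo-Hessian structure `𝔅` with `𝔅^♮` bijective and
a linear map `N` with `𝔅(Nx,y) = 𝔅(x,Ny)`, `(𝔅,N)` is an HN-structure (in
particular `N` is Nijenhuis) iff `𝔅_N` and `𝔅_{N²}` are both 2-cocycles. -/
theorem HN_iff_two_cocycles
    (mul : A →ₗ[ℝ] A →ₗ[ℝ] A) (hls : IsLS mul)
    (B : A →ₗ[ℝ] Dual ℝ A) (hsymB : IsSymmB B) (hB : IsCocycle mul B)
    (K : Dual ℝ A →ₗ[ℝ] A) (hK1 : ∀ x : A, K (B x) = x)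
    (hK2 : ∀ α : Dual ℝ A, B (K α) = α)
    (N : A →ₗ[ℝ] A) (hNsym : ∀ x y : A, B (N x) y = B x (N y)) :
    IsHN mul B N ↔ (IsCocycle mul (B ∘ₗ N) ∧ IsCocycle mul (B ∘ₗ (N ∘ₗ N))) := by
  have key : ∀ x y z : A,
      B x (mul (N y) (N z) - N (mul (N y) z + mul y (N z) - N (mul y z))) =
        (B (N (N x)) (mul y z) - B (N (N y)) (mul x z) - B (N (N (br mul x y))) z)
        - (B (N x) (mul (N y) z) - B (N (N y)) (mul x z) - B (N (br mul x (N y))) z)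
        - (B (N x) (mul y (N z)) - B (N y) (mul x (N z)) - B (N (br mul x y)) (N z))
        + (B x (mul (N y) (N z)) - B (N y) (mul x (N z)) - B (br mul x (N y)) (N z)) := by
    intro x y z
    simp only [map_sub, map_add, hNsym]
    ring
  constructor
  · rintro ⟨-, -, hN, -, h1⟩
    refine ⟨h1, fun x y z => ?_⟩
    have k := key x y z
    have a := h1 x (N y) z
    have b := h1 x y (N z)
    have c := hB x (N y) (N z)
    simp only [LinearMap.comp_apply] at a b ⊢
    rw [sub_eq_zero.mpr (hN y z), map_zero] at k
    linarith
  · rintro ⟨h1, h2⟩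
    refine ⟨hsymB, hB, fun y z => ?_, hNsym, h1⟩
    rw [← sub_eq_zero]
    have hz : B (mul (N y) (N z) - N (mul (N y) z + mul y (N z) - N (mul y z))) = 0 := by
      ext x
      rw [hsymB, key x y z]
      have a := h1 x (N y) z
      have b := h1 x y (N z)
      have c := hB x (N y) (N z)
      have d := h2 x y z
      simp only [LinearMap.comp_apply] at a b d
      rw [a, b, c, d]
      simp
    rw [← hK1 (mul (N y) (N z) - N (mul (N y) z + mul y (N z) - N (mul y z))), hz, map_zero]
end
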